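/- For every pair of non-negative integers n and m, MO(3m+2; 3n+1) ≡ 0 (mod 3) and MO(3m+2; 3n+2) ≡ 0 (mod 3). -/

import Mathlib

open Finset

/-- `MO a n` is MacMahon's coefficient: the sum of the products `s_1 ⋯ s_a` over all
strictly increasing tuples `0 < k_1 < ⋯ < k_a` of positive integers and positive
integers `s_1, …, s_a` with `s_1*k_1 + ⋯ + s_a*k_a = n` (all such data satisfy
`k_i, s_i ≤ n`, so we may sum over a finite set); in particular `MO a 0 = 0` for `a ≥ 1`. -/
def MO (a n : ℕ) : ℕ :=
  ∑ f ∈ Finset.univ.filter (fun f : Fin a → Fin (n + 1) × Fin (n + 1) =>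
      (∀ i, 0 < ((f i).1 : ℕ) ∧ 0 < ((f i).2 : ℕ)) ∧
      (∀ i j : Fin a, i < j → (f i).1 < (f j).1) ∧
      (∑ i, ((f i).2 : ℕ) * ((f i).1 : ℕ)) = n),
    ∏ i, ((f i).2 : ℕ)

/-- The product `(1 - q)(1 - q²)⋯(1 - qⁿ)`. -/
def qFactor {A : Type*} [CommRing A] (q : A) (n : ℕ) : A :=
  ∏ k ∈ range n, (1 - q ^ (k + 1))

theorem qFactor_succ {A : Type*} [CommRing A] (q : A) (n : ℕ) :
    qFactor q (n + 1) = qFactor q n * (1 - q ^ (n + 1)) :=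
  prod_range_succ _ _

theorem pow_succ_dvd_qFactor_sub {A : Type*} [CommRing A] (q : A) (m j : ℕ) :
    q ^ (m + 1) ∣ qFactor q (m + j) - qFactor q m := by
  induction j with
  | zero => simp
  | succ j ih =>
    have h : qFactor q (m + (j + 1)) - qFactor q m
        = (qFactor q (m + j) - qFactor q m) - q ^ (m + 1) * (q ^ j * qFactor q (m + j)) := by
      rw [← add_assoc, qFactor_succ]; ring
    rw [h]
    exact dvd_sub ih (dvd_mul_right _ _)

/-- The coefficients in the expansion of `∏_{k ≤ N} ((1 - q^k)² + q^k x)` along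
the polynomials `dirichletPoly`, up to sign. -/
def thetaCoeff {A : Type*} [CommRing A] (q : A) : ℕ → ℕ → A
  | 0, 0 => 1
  | 0, _ + 1 => 0
  | N + 1, 0 => (1 + q ^ (2 * (N + 1)) + q ^ (N + 1)) * thetaCoeff q N 0
      + q ^ (N + 1) * thetaCoeff q N 1
  | N + 1, n + 1 => (1 + q ^ (2 * (N + 1))) * thetaCoeff q N (n + 1)
      + q ^ (N + 1) * (thetaCoeff q N n + thetaCoeff q N (n + 2))

theorem thetaCoeff_eq_zero {A : Type*} [CommRing A] (q : A) {N n : ℕ} (h : N < n) :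
    thetaCoeff q N n = 0 := by
  induction N generalizing n with
  | zero => obtain ⟨n, rfl⟩ := Nat.exists_eq_add_of_lt h; simp [thetaCoeff]
  | succ N ih =>
    obtain ⟨n, rfl⟩ : ∃ m, n = m + 1 := ⟨n - 1, by omega⟩
    simp [thetaCoeff, ih (show N < n by omega), ih (show N < n + 1 by omega),
      ih (show N < n + 2 by omega)]

/-- `thetaCoeff q N n` is `q ^ (n (n + 1) / 2)` times the Gaussian binomial coefficient
`2N + 1` over `N - n`. -/
theorem qFactor_mul_thetaCoeff {A : Type*} [CommRing A] (q : A) {N n : ℕ} (h : n ≤ N) :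
    qFactor q (N - n) * qFactor q (N + n + 1) * thetaCoeff q N n
      = q ^ (n + 1).choose 2 * qFactor q (2 * N + 1) := by
  induction N generalizing n with
  | zero => obtain rfl : n = 0 := by omega
            simp [thetaCoeff, qFactor]
  | succ N ih =>
    have middle : ∀ n ≤ N + 1, qFactor q (N + 1 - n) * qFactor q (N + n + 2) * thetaCoeff q N n
        = (1 - q ^ (N + 1 - n)) * (1 - q ^ (N + n + 2))
          * (q ^ (n + 1).choose 2 * qFactor q (2 * N + 1)) := by
      intro n hn
      rcases Nat.lt_or_ge N n with hlt | hle
      · simp [thetaCoeff_eq_zero q hlt, show N + 1 - n = 0 by omega]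
      · rw [← ih hle, Nat.succ_sub hle, Nat.succ_eq_add_one, qFactor_succ,
          qFactor_succ q (N + n + 1)]
        ring
    have upper : ∀ n ≤ N + 1,
        qFactor q (N + 1 - n) * qFactor q (N + n + 2) * thetaCoeff q N (n + 1)
        = (1 - q ^ (N + 1 - n)) * (1 - q ^ (N - n))
          * (q ^ (n + 2).choose 2 * qFactor q (2 * N + 1)) := by
      intro n hn
      rcases Nat.lt_or_ge N (n + 1) with hlt | hle
      · simp [thetaCoeff_eq_zero q hlt, show N - n = 0 by omega]
      · rw [← ih hle]
        obtain ⟨j, rfl⟩ := Nat.exists_eq_add_of_le hle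
        rw [show n + 1 + j + 1 - n = j + 1 + 1 by omega, show n + 1 + j - (n + 1) = j by omega,
          show n + 1 + j - n = j + 1 by omega, qFactor_succ, qFactor_succ]
        ring_nf
    have top : qFactor q (2 * (N + 1) + 1)
        = qFactor q (2 * N + 1) * (1 - q ^ (2 * N + 2)) * (1 - q ^ (2 * N + 3)) := by
      rw [show 2 * (N + 1) + 1 = 2 * N + 1 + 1 + 1 by ring, qFactor_succ, qFactor_succ]
    have choose_two : ∀ k, (k + 2).choose 2 = k + 1 + (k + 1).choose 2 := fun k => by
      rw [Nat.choose_succ_succ, Nat.choose_one_right]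
    rw [top]
    cases n with
    | zero =>
      have h0 := middle 0 (by omega)
      have h1 := upper 0 (by omega)
      simp only [Nat.sub_zero, add_zero, zero_add, thetaCoeff, Nat.choose_self, pow_one,
        Nat.choose_succ_self, pow_zero, show N + 1 + 0 + 1 = N + 2 by ring, one_mul] at h0 h1 ⊢
      linear_combination (1 + q ^ (2 * (N + 1)) + q ^ (N + 1)) * h0 + q ^ (N + 1) * h1
    | succ n =>
      obtain ⟨j, rfl⟩ := Nat.exists_eq_add_of_le (show n ≤ N by omega)
      have h0 := middle (n + 1) (by omega)
      have h1 := upper (n + 1) (by omega)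
      have h2 : qFactor q (n + j + 1 - (n + 1)) * qFactor q (n + j + (n + 1) + 2)
          * thetaCoeff q (n + j) n = (1 - q ^ (n + j + n + 2)) * (1 - q ^ (n + j + n + 3))
          * (q ^ (n + 1).choose 2 * qFactor q (2 * (n + j) + 1)) := by
        rw [← ih (show n ≤ n + j by omega), show n + j + 1 - (n + 1) = j by omega,
          show n + j - n = j by omega,
          show n + j + (n + 1) + 2 = n + j + n + 1 + 1 + 1 by ring, qFactor_succ, qFactor_succ]
        ring
      rw [show n + j + 1 + (n + 1) + 1 = n + j + (n + 1) + 2 by ring]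
      simp only [thetaCoeff, choose_two,
        show n + 1 + 1 = n + 2 by ring, pow_add q (n + 1)] at h0 h1 h2 ⊢
      obtain - | j := j
      · simp only [add_zero, show n + 1 - (n + 1) = 0 by omega, pow_zero, sub_self, zero_mul] at *
        linear_combination (1 + q ^ (2 * (n + 1))) * h0 + q ^ (n + 1) * (h1 + h2)
      · rw [show n + (j + 1) - (n + 1) = j by omega,
          show n + (j + 1) + 1 - (n + 1) = j + 1 by omega] at *
        linear_combination (1 + q ^ (2 * (n + (j + 1) + 1))) * h0
          + q ^ (n + (j + 1) + 1) * (h1 + h2)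

theorem pow_dvd_qFactor_mul_thetaCoeff_sub {R : Type*} [Field R] {N n : ℕ} (h : n ≤ N) :
    (PowerSeries.X : PowerSeries R) ^ (N + 1) ∣
      qFactor PowerSeries.X N * thetaCoeff PowerSeries.X N n
        - PowerSeries.X ^ (n + 1).choose 2 := by
  set q : PowerSeries R := PowerSeries.X with hq
  obtain ⟨m, rfl⟩ := Nat.exists_eq_add_of_le' h
  have unit : ∀ k, IsUnit (qFactor q k) := fun k => by
    rw [PowerSeries.isUnit_iff_constantCoeff]
    simp [qFactor, hq]
  have key := qFactor_mul_thetaCoeff q h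
  rw [Nat.add_sub_cancel] at key
  rw [← ((unit m).mul (unit (m + n + n + 1))).dvd_mul_left]
  have expand : qFactor q m * qFactor q (m + n + n + 1) *
      (qFactor q (m + n) * thetaCoeff q (m + n) n - q ^ (n + 1).choose 2)
      = q ^ (n + 1).choose 2 * (qFactor q (m + n) * (qFactor q (2 * (m + n) + 1) - qFactor q m)
        - qFactor q m * (qFactor q (m + n + n + 1) - qFactor q m)
        + qFactor q m * (qFactor q (m + n) - qFactor q m)) := by
    linear_combination qFactor q (m + n) * key
  rw [expand]
  have hle : m + n + 1 ≤ (n + 1).choose 2 + (m + 1) := by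
    have : (n + 1).choose 2 = n + n.choose 2 := by
      rw [Nat.choose_succ_succ, Nat.choose_one_right]
    omega
  refine (pow_dvd_pow q hle).trans ?_
  rw [pow_add]
  refine mul_dvd_mul_left _ (dvd_add (dvd_sub ?_ ?_) ?_) <;> apply Dvd.dvd.mul_left
  · rw [show 2 * (m + n) + 1 = m + (m + 2 * n + 1) by ring]
    exact pow_succ_dvd_qFactor_sub q m _
  · rw [show m + n + n + 1 = m + (n + n + 1) by ring]
    exact pow_succ_dvd_qFactor_sub q m _
  · exact pow_succ_dvd_qFactor_sub q m _

open Polynomial in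
/-- The polynomial in `x` equal to `z⁻ⁿ + ⋯ + zⁿ` when `x = 2 - z - z⁻¹`. -/
noncomputable def dirichletPoly (A : Type*) [CommRing A] : ℕ → A[X]
  | 0 => 1
  | 1 => 3 - X
  | n + 2 => (2 - X) * dirichletPoly A (n + 1) - dirichletPoly A n

theorem map_dirichletPoly {A B : Type*} [CommRing A] [CommRing B] (f : A →+* B) (n : ℕ) :
    (dirichletPoly A n).map f = dirichletPoly B n := by
  induction n using Nat.twoStepInduction with
  | zero => simp [dirichletPoly]
  | one => simp [dirichletPoly]
  | more n h₀ h₁ => simp [dirichletPoly, h₀, h₁]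

open Polynomial in
theorem prod_eq_sum_thetaCoeff_mul_dirichletPoly {A : Type*} [CommRing A] (q : A) (N : ℕ) :
    ∏ k ∈ range N, (C ((1 - q ^ (k + 1)) ^ 2) + X * C (q ^ (k + 1)))
      = ∑ n ∈ range (N + 1), C ((-1) ^ n * thetaCoeff q N n) * dirichletPoly A n := by
  induction N with
  | zero => simp [thetaCoeff, dirichletPoly]
  | succ N ih =>
    have telescope : ∀ L,
        ∑ n ∈ range (L + 1), C ((-1) ^ n * thetaCoeff q (N + 1) n) * dirichletPoly A n
        = (∑ n ∈ range (L + 1), C ((-1) ^ n * thetaCoeff q N n) * dirichletPoly A n)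
            * (C ((1 - q ^ (N + 1)) ^ 2) + X * C (q ^ (N + 1)))
          + C ((-1) ^ L * q ^ (N + 1)) * (C (thetaCoeff q N (L + 1)) * dirichletPoly A L
            + C (thetaCoeff q N L) * dirichletPoly A (L + 1)) := by
      intro L
      induction L with
      | zero =>
        simp only [zero_add, sum_range_one, thetaCoeff, dirichletPoly, map_add, map_mul, map_pow,
          map_sub, map_neg, map_one, pow_zero]
        ring
      | succ L ihL =>
        rw [sum_range_succ, sum_range_succ _ (L + 1), ihL]
        simp only [thetaCoeff, dirichletPoly, map_add, map_mul, map_pow,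
          map_sub, map_neg, map_one]
        ring
    rw [prod_range_succ, ih, telescope, sum_range_succ _ (N + 1),
      thetaCoeff_eq_zero q (Nat.lt_succ_self N), thetaCoeff_eq_zero q (show N < N + 1 + 1 by omega)]
    simp

open Polynomial in
theorem dirichletPoly_three_mul_add_one (k : ℕ) :
    dirichletPoly (ZMod 3) (3 * k + 1)
      = -(X * expand (ZMod 3) 3 (dirichletPoly (ZMod 3) k)) := by
  have three : (3 : (ZMod 3)[X]) = 0 := CharP.ofNat_eq_zero _ 3
  induction k using Nat.twoStepInduction with
  | zero => simp [dirichletPoly, three]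
  | one =>
    simp only [dirichletPoly, map_sub, expand_X, map_ofNat]
    linear_combination (3 - 9 * X + 9 * X ^ 2 - 3 * X ^ 3) * three
  | more k h₀ h₁ =>
    have step : ∀ n, dirichletPoly (ZMod 3) (n + 6)
        = (2 - X ^ 3) * dirichletPoly (ZMod 3) (n + 3) - dirichletPoly (ZMod 3) n := by
      intro n
      simp only [dirichletPoly]
      linear_combination (2 * X ^ 2 - 3 * X) * ((2 - X) * ((2 - X) * dirichletPoly (ZMod 3) (n + 1)
        - dirichletPoly (ZMod 3) n) - dirichletPoly (ZMod 3) (n + 1)) * three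
    rw [show 3 * (k + 2) + 1 = 3 * k + 1 + 6 by ring, step,
      show 3 * k + 1 + 3 = 3 * (k + 1) + 1 by ring, h₀, h₁]
    simp only [dirichletPoly, map_sub, map_mul, expand_X, map_ofNat]
    ring

open Polynomial in
theorem choose_two_mul_coeff_dirichletPoly (n a : ℕ) (ha : a % 3 = 2) :
    ((n + 1).choose 2 : ZMod 3) * (dirichletPoly (ZMod 3) n).coeff a = 0 := by
  have two_mul_choose : 2 * ((n + 1).choose 2 : ZMod 3) = (n + 1) * n := by
    have h' : (n + 1).choose 2 * 2 = (n + 1) * n := by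
      rw [Nat.choose_two_right, Nat.add_sub_cancel, Nat.div_mul_cancel]
      exact (Nat.even_mul_succ_self n).two_dvd.trans ((mul_comm _ _).dvd)
    rw [mul_comm]
    exact_mod_cast congrArg (Nat.cast : ℕ → ZMod 3) h'
  have two_ne : (2 : ZMod 3) ≠ 0 := by decide
  obtain h | ⟨k, rfl⟩ : (n % 3 = 0 ∨ n % 3 = 2) ∨ ∃ k, n = 3 * k + 1 := by
    by_cases h : n % 3 = 1
    · exact Or.inr ⟨n / 3, by omega⟩
    · exact Or.inl (by omega)
  · have : ((n + 1).choose 2 : ZMod 3) = 0 := by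
      refine (mul_eq_zero.mp (two_mul_choose.trans ?_)).resolve_left two_ne
      have : ((((n + 1) * n : ℕ)) : ZMod 3) = 0 := by
        rw [ZMod.natCast_eq_zero_iff]
        rcases h with h | h
        · exact Dvd.dvd.mul_left (by omega) _
        · exact Dvd.dvd.mul_right (by omega) _
      exact_mod_cast this
    rw [this, zero_mul]
  · obtain ⟨a, rfl⟩ : ∃ b, a = b + 1 := ⟨a - 1, by omega⟩
    rw [dirichletPoly_three_mul_add_one, coeff_neg, coeff_X_mul, coeff_expand (by norm_num),
      if_neg (by omega)]
    simp

theorem dvd_prod_sub_prod {ι A : Type*} [CommRing A] {d : A} {f g : ι → A} {s : Finset ι}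
    (h : ∀ i ∈ s, d ∣ f i - g i) : d ∣ ∏ i ∈ s, f i - ∏ i ∈ s, g i := by
  simp only [← Ideal.mem_span_singleton, ← Ideal.Quotient.eq, map_prod] at h ⊢
  exact prod_congr rfl h

theorem one_sub_sq_mul_sum {A : Type*} [CommRing A] (y : A) (N : ℕ) :
    (1 - y) ^ 2 * ∑ s ∈ range (N + 1), (s : A) * y ^ s
      = y - (N + 1) * y ^ (N + 1) + N * y ^ (N + 2) := by
  induction N with
  | zero => simp
  | succ N ih =>
    rw [sum_range_succ, mul_add, ih]
    push_cast
    ring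

/-- Truncation of MacMahon's generating function `∑ₐ 𝒰ₐ(q) xᵃ`. -/
noncomputable def macMahonSeries {A : Type*} [CommRing A] (q : A) (N : ℕ) : Polynomial A :=
  ∏ k ∈ range N,
    (1 + Polynomial.X * Polynomial.C (∑ s ∈ range (N + 1), (s : A) * (q ^ (k + 1)) ^ s))

open Polynomial in
theorem pow_dvd_qFactor_sq_mul_macMahonSeries_sub {A : Type*} [CommRing A] (q : A) (N : ℕ) :
    C (q ^ (N + 1)) ∣ C (qFactor q N ^ 2) * macMahonSeries q N
      - ∏ k ∈ range N, (C ((1 - q ^ (k + 1)) ^ 2) + X * C (q ^ (k + 1))) := by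
  rw [qFactor, ← prod_pow, map_prod, macMahonSeries, ← prod_mul_distrib]
  refine dvd_prod_sub_prod fun k _ => ?_
  have h := one_sub_sq_mul_sum (q ^ (k + 1)) N
  have expand : C ((1 - q ^ (k + 1)) ^ 2)
        * (1 + X * C (∑ s ∈ range (N + 1), (s : A) * (q ^ (k + 1)) ^ s))
        - (C ((1 - q ^ (k + 1)) ^ 2) + X * C (q ^ (k + 1)))
      = C (q ^ (N + 1)) * (X * C (q ^ (k * (N + 1)) * (N * q ^ (k + 1) - (N + 1)))) := by
    rw [mul_add, mul_one, mul_left_comm, ← C_mul, h, add_sub_add_left_eq_sub, ← mul_sub,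
      mul_left_comm, ← C_mul, ← C_sub]
    congr 2
    ring
  rw [expand]
  exact dvd_mul_right _ _

theorem pow_dvd_qFactor_cube_mul_coeff_sub (N a : ℕ) :
    (PowerSeries.X : PowerSeries (ZMod 3)) ^ (N + 1) ∣
      qFactor PowerSeries.X N ^ 3 * (macMahonSeries PowerSeries.X N).coeff a
      - ∑ n ∈ range (N + 1), (-1) ^ n * PowerSeries.X ^ (n + 1).choose 2
        * PowerSeries.C ((dirichletPoly (ZMod 3) n).coeff a) := by
  have h := (Polynomial.C_dvd_iff_dvd_coeff _ _).mp
    (pow_dvd_qFactor_sq_mul_macMahonSeries_sub (PowerSeries.X : PowerSeries (ZMod 3)) N) a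
  rw [prod_eq_sum_thetaCoeff_mul_dirichletPoly, Polynomial.coeff_sub, Polynomial.coeff_C_mul,
    Polynomial.finsetSum_coeff] at h
  simp only [Polynomial.coeff_C_mul] at h
  have h' : (PowerSeries.X : PowerSeries (ZMod 3)) ^ (N + 1) ∣
      ∑ n ∈ range (N + 1), (qFactor PowerSeries.X N * thetaCoeff PowerSeries.X N n
        - PowerSeries.X ^ (n + 1).choose 2)
        * ((-1) ^ n * (dirichletPoly (PowerSeries (ZMod 3)) n).coeff a) :=
    dvd_sum fun n hn =>
      (pow_dvd_qFactor_mul_thetaCoeff_sub (Nat.lt_succ_iff.mp (mem_range.mp hn))).mul_right _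
  have total := dvd_add (h.mul_left (qFactor PowerSeries.X N)) h'
  convert total using 1
  rw [mul_sub, mul_sum, sub_add, ← sum_sub_distrib]
  congr 1
  · ring
  · refine sum_congr rfl fun n _ => ?_
    rw [← map_dirichletPoly (PowerSeries.C (R := ZMod 3)), Polynomial.coeff_map]
    ring

theorem pow_dvd_derivative {R : Type*} [CommRing R] {f : PowerSeries R} {N : ℕ}
    (h : PowerSeries.X ^ (N + 1) ∣ f) :
    PowerSeries.X ^ N ∣ PowerSeries.derivative R f := by
  rw [PowerSeries.X_pow_dvd_iff] at h ⊢
  intro d hd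
  rw [PowerSeries.coeff_derivative, h (d + 1) (by omega), zero_mul]

open PowerSeries in
theorem coeff_coeff_macMahonSeries {N a : ℕ} (hN : ¬ 3 ∣ N) (ha : a % 3 = 2) :
    PowerSeries.coeff N ((macMahonSeries (X : (ZMod 3)⟦X⟧) N).coeff a) = 0 := by
  have h := pow_dvd_derivative (pow_dvd_qFactor_cube_mul_coeff_sub N a)
  have three : (3 : (ZMod 3)⟦X⟧) = 0 := by
    rw [← map_ofNat (PowerSeries.C (R := ZMod 3)), show (OfNat.ofNat 3 : ZMod 3) = 0 from rfl,
      map_zero]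
  have hpow : derivative (ZMod 3) (qFactor (X : (ZMod 3)⟦X⟧) N ^ 3) = 0 := by
    rw [derivative_pow]
    simp [three]
  have hsum : derivative (ZMod 3) (∑ n ∈ range (N + 1), (-1) ^ n * X ^ (n + 1).choose 2
        * PowerSeries.C ((dirichletPoly (ZMod 3) n).coeff a)) = 0 := by
    rw [map_sum]
    refine sum_eq_zero fun n _ => ?_
    have hc := congrArg (PowerSeries.C (R := ZMod 3)) (choose_two_mul_coeff_dirichletPoly n a ha)
    rw [map_mul, map_natCast, map_zero] at hc
    have hone : derivative (ZMod 3) ((-1 : (ZMod 3)⟦X⟧) ^ n) = 0 := by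
      simp
    rw [Derivation.leibniz, Derivation.leibniz, hone, derivative_C, derivative_pow]
    simp only [smul_eq_mul, derivative_X]
    linear_combination ((-1) ^ n * X ^ ((n + 1).choose 2 - 1)) * hc
  rw [map_sub, hsum, Derivation.leibniz, hpow, smul_zero, add_zero, sub_zero, smul_eq_mul] at h
  have unit : IsUnit (qFactor (X : (ZMod 3)⟦X⟧) N ^ 3) := by
    rw [PowerSeries.isUnit_iff_constantCoeff]
    simp [qFactor]
  rw [unit.dvd_mul_left, X_pow_dvd_iff] at h
  obtain ⟨M, rfl⟩ : ∃ M, N = M + 1 := ⟨N - 1, by omega⟩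
  have hM := h M (Nat.lt_succ_self M)
  rw [coeff_derivative] at hM
  refine (mul_eq_zero.mp hM).resolve_right ?_
  rw [← ZMod.natCast_eq_zero_iff] at hN
  exact_mod_cast hN

theorem sum_powersetCard_prod_eq_sum_strictMono {α A : Type*} [LinearOrder α] [Fintype α]
    [CommRing A] (p : α → Prop) [DecidablePred p] (φ : α → A) (a : ℕ) :
    ∑ t ∈ powersetCard a (univ.filter p), ∏ k ∈ t, φ k
      = ∑ k : Fin a → α with (∀ i, p (k i)) ∧ StrictMono k, ∏ i, φ (k i) := by
  symm
  refine sum_bij (fun k _ => univ.image k) ?_ ?_ ?_ ?_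
  · intro k hk
    simp only [mem_filter, mem_univ, true_and] at hk
    rw [mem_powersetCard, card_image_of_injective _ hk.2.injective]
    refine ⟨fun x hx => ?_, by simp⟩
    obtain ⟨i, -, rfl⟩ := mem_image.mp hx
    simpa using hk.1 i
  · intro k hk l hl hkl
    simp only [mem_filter, mem_univ, true_and] at hk hl
    refine (hk.2.range_inj hl.2).mp ?_
    simpa using congrArg (fun t : Finset α => (t : Set α)) hkl
  · intro t ht
    rw [mem_powersetCard] at ht
    refine ⟨t.orderEmbOfFin ht.2, ?_, image_orderEmbOfFin_univ t ht.2⟩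
    simp only [mem_filter, mem_univ, true_and]
    exact ⟨fun i => by simpa using ht.1 (orderEmbOfFin_mem t ht.2 i), OrderEmbedding.strictMono _⟩
  · intro k hk
    simp only [mem_filter, mem_univ, true_and] at hk
    rw [prod_image hk.2.injective.injOn]

theorem coeff_macMahonSeries {A : Type*} [CommRing A] (q : A) (N a : ℕ) :
    (macMahonSeries q N).coeff a
      = ∑ k : Fin a → Fin (N + 1) with (∀ i, 0 < (k i : ℕ)) ∧ StrictMono k,
          ∏ i, ∑ s : Fin (N + 1), (s : A) * q ^ ((s : ℕ) * (k i : ℕ)) := by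
  have reindex : macMahonSeries q N = ∏ k ∈ univ.filter (fun k : Fin (N + 1) => 0 < (k : ℕ)),
      (1 + Polynomial.X * Polynomial.C (∑ s : Fin (N + 1), (s : A) * q ^ ((s : ℕ) * (k : ℕ)))) := by
    rw [prod_filter, Fin.prod_univ_succ, macMahonSeries, prod_range]
    simp only [Fin.val_zero, lt_irrefl, if_false, one_mul, Fin.val_succ, Nat.succ_pos, if_true]
    refine prod_congr rfl fun k _ => ?_
    rw [sum_range]
    simp only [← pow_mul, mul_comm]
  rw [reindex, prod_one_add, Polynomial.finsetSum_coeff,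
    ← sum_powersetCard_prod_eq_sum_strictMono (fun k : Fin (N + 1) => 0 < (k : ℕ))
      (fun k => ∑ s : Fin (N + 1), (s : A) * q ^ ((s : ℕ) * (k : ℕ))),
    powersetCard_eq_filter, sum_filter]
  refine sum_congr rfl fun t _ => ?_
  rw [prod_mul_distrib, prod_const, ← map_prod, Polynomial.coeff_mul_C, Polynomial.coeff_X_pow]
  simp [eq_comm]

theorem coeff_coeff_macMahonSeries_eq_MO {R : Type*} [CommRing R] (N a : ℕ) :
    PowerSeries.coeff N ((macMahonSeries (PowerSeries.X : PowerSeries R) N).coeff a)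
      = (MO a N : R) := by
  rw [coeff_macMahonSeries, MO, Nat.cast_sum, sum_filter, sum_filter,
    ← (Equiv.arrowProdEquivProdArrow (Fin a) (fun _ => Fin (N + 1))
      (fun _ => Fin (N + 1))).symm.sum_comp,
    Fintype.sum_prod_type, map_sum]
  refine sum_congr rfl fun k _ => ?_
  by_cases hk : (∀ i, 0 < (k i : ℕ)) ∧ StrictMono k
  · rw [if_pos hk, prod_univ_sum, map_sum, Fintype.piFinset_univ]
    refine sum_congr rfl fun s _ => ?_
    have hmono : ∀ i j, i < j → k i < k j := fun i j => @hk.2 i j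
    have hprod : ∏ i, ((s i : ℕ) : PowerSeries R) * PowerSeries.X ^ ((s i : ℕ) * (k i : ℕ))
        = PowerSeries.C ((∏ i, (s i : ℕ) : ℕ) : R)
          * PowerSeries.X ^ ∑ i, (s i : ℕ) * (k i : ℕ) := by
      rw [prod_mul_distrib, prod_pow_eq_pow_sum, map_natCast, Nat.cast_prod]
    rw [hprod, PowerSeries.coeff_C_mul, PowerSeries.coeff_X_pow]
    by_cases hs : ∀ i, 0 < (s i : ℕ)
    · by_cases hN : ∑ i, (s i : ℕ) * (k i : ℕ) = N
      · rw [if_pos hN.symm, if_pos ⟨fun i => ⟨hk.1 i, hs i⟩, hmono, hN⟩, mul_one]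
        rfl
      · simp [hN, Ne.symm hN, Equiv.arrowProdEquivProdArrow]
    · have hzero : ∏ i, (s i : ℕ) = 0 := by
        push Not at hs
        obtain ⟨i, hi⟩ := hs
        exact prod_eq_zero (mem_univ i) (by omega)
      simp only [Equiv.arrowProdEquivProdArrow, Equiv.coe_fn_symm_mk]
      simp [hzero]
  · rw [if_neg hk, map_zero]
    refine (sum_eq_zero fun s _ => if_neg ?_).symm
    rintro ⟨hpos, hmono, -⟩
    exact hk ⟨fun i => (hpos i).1, fun i j => hmono i j⟩

theorem three_dvd_MO {N a : ℕ} (hN : ¬ 3 ∣ N) (ha : a % 3 = 2) : 3 ∣ MO a N := by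
  rw [← ZMod.natCast_eq_zero_iff, ← coeff_coeff_macMahonSeries_eq_MO]
  exact coeff_coeff_macMahonSeries hN ha

/-- for all non-negative integers `n` and `m`,
`MO (3m+2; 3n+1) ≡ MO (3m+2; 3n+2) ≡ 0 (mod 3)`. -/
theorem MO_mod_three (n m : ℕ) :
    3 ∣ MO (3 * m + 2) (3 * n + 1) ∧ 3 ∣ MO (3 * m + 2) (3 * n + 2) :=
  ⟨three_dvd_MO (by omega) (by omega), three_dvd_MO (by omega) (by omega)⟩
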